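/- (Team problems are weakly acyclic.) Every finite discounted stochastic game in which all DMs have the same cost function c^1 = ⋯ = c^N and the same discount factor β^1 = ⋯ = β^N (a team problem) is weakly acyclic under strict best replies: from every deterministic joint policy there is a strict best reply path ending at a deterministic equilibrium policy. -/

import Mathlib

open MeasureTheory Filter
open scoped Classical

noncomputable section

namespace DQ

/-- A finite discounted stochastic game: `N` decision makers, finite state space `X`,
finite decision sets `U i`, cost functions `c`, discount factors `β`, transition kernel `P`. -/
structure Game (N : ℕ) (X : Type*) (U : Fin N → Type*) [Fintype X] where
  c : Fin N → X → (∀ i, U i) → ℝ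
  β : Fin N → ℝ
  β_pos : ∀ i, 0 < β i
  β_lt_one : ∀ i, β i < 1
  P : X → (∀ i, U i) → X → ℝ
  P_nonneg : ∀ x u y, 0 ≤ P x u y
  P_sum_one : ∀ x u, ∑ y, P x u y = 1

/-- The parameters of the learning algorithms (experimentation probabilities `ρ`,
inertias `lam`, tolerance levels `δ`, step sizes `α`, and the compact reset sets `Qset`). -/
structure Params (N : ℕ) (X : Type*) (U : Fin N → Type*)
    [Fintype X] [∀ i, Fintype (U i)] where
  ρ : Fin N → ℝ
  lam : Fin N → ℝ
  δ : Fin N → ℝ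
  ρ_mem : ∀ i, 0 < ρ i ∧ ρ i < 1
  lam_mem : ∀ i, 0 < lam i ∧ lam i < 1
  δ_pos : ∀ i, 0 < δ i
  α : Fin N → ℕ → ℝ
  α_mem : ∀ i n, 0 ≤ α i n ∧ α i n ≤ 1
  α_div : ∀ i, ¬ Summable (α i)
  α_sq : ∀ i, Summable fun n => α i n ^ 2
  Qset : (i : Fin N) → Set (X → U i → ℝ)
  Qset_compact : ∀ i, IsCompact (Qset i)
  Qset_nonempty : ∀ i, (Qset i).Nonempty

variable {N : ℕ} {X : Type*} {U : Fin N → Type*}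
variable [Fintype X] [Nonempty X] [∀ i, Fintype (U i)] [∀ i, Nonempty (U i)]
variable [DecidableEq X] [∀ i, DecidableEq (U i)]

/-- A deterministic stationary policy of DM `i`, embedded as a randomized policy. -/
def detP {i : Fin N} (p : X → U i) : X → U i → ℝ := fun x a => if a = p x then 1 else 0

/-- A deterministic joint policy viewed as a randomized policy profile. -/
def detJ (π : ∀ i, X → U i) : ∀ i, X → U i → ℝ := fun i => detP (π i)

/-- `σi` is a randomized stationary policy for DM `i`. -/
def IsRandPol {i : Fin N} (σi : X → U i → ℝ) : Prop :=
  ∀ x, (∀ a, 0 ≤ σi x a) ∧ ∑ a, σi x a = 1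

/-- `σ` is a randomized stationary joint policy profile. -/
def IsProfile (σ : ∀ i, X → U i → ℝ) : Prop := ∀ i, IsRandPol (σ i)

/-- Probability of the joint decision `a` at state `x` under the profile `σ`. -/
def jointProb (σ : ∀ i, X → U i → ℝ) (x : X) (a : ∀ i, U i) : ℝ := ∏ i, σ i x (a i)

/-- Point mass at `x`. -/
def dirac (x : X) : X → ℝ := fun y => if y = x then 1 else 0

/-- One-step evolution of the state distribution under the profile `σ`. -/
def stepOp (G : Game N X U) (σ : ∀ i, X → U i → ℝ) (μd : X → ℝ) : X → ℝ :=
  fun y => ∑ x, μd x * ∑ a, jointProb σ x a * G.P x a y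

/-- Expected one-stage cost of DM `i` under the state distribution `μd` and profile `σ`. -/
def stageCost (G : Game N X U) (σ : ∀ i, X → U i → ℝ) (i : Fin N) (μd : X → ℝ) : ℝ :=
  ∑ x, μd x * ∑ a, jointProb σ x a * G.c i x a

/-- Expected discounted cost `J^i_x(σ)` of DM `i`, starting at `x`, under the profile `σ`. -/
def J (G : Game N X U) (σ : ∀ i, X → U i → ℝ) (i : Fin N) (x : X) : ℝ :=
  ∑' t : ℕ, G.β i ^ t * stageCost G σ i ((stepOp G σ)^[t] (dirac x))

/-- `p` is a deterministic best reply of DM `i` to the profile `σ` (only the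
components `σ j`, `j ≠ i`, matter): it attains the minimum of `J^i_x` over randomized
stationary policies simultaneously for every initial state `x`. -/
def IsBestReply (G : Game N X U) (i : Fin N) (σ : ∀ j, X → U j → ℝ) (p : X → U i) : Prop :=
  ∀ (x : X) (σi : X → U i → ℝ), IsRandPol σi →
    J G (Function.update σ i (detP p)) i x ≤ J G (Function.update σ i σi) i x

/-- (Markov perfect) equilibrium among deterministic joint policies. -/
def IsEquilibrium (G : Game N X U) (π : ∀ i, X → U i) : Prop :=
  ∀ i, IsBestReply G i (detJ π) (π i)

/-- A strict best reply of DM `i` with respect to the deterministic joint policy `π`. -/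
def IsStrictBestReply (G : Game N X U) (i : Fin N) (π : ∀ j, X → U j) (p : X → U i) : Prop :=
  IsBestReply G i (detJ π) p ∧
  ∃ x, J G (detJ (Function.update π i p)) i x < J G (detJ π) i x

/-- A strict better reply of DM `i` with respect to the deterministic joint policy `π`. -/
def IsStrictBetterReply (G : Game N X U) (i : Fin N) (π : ∀ j, X → U j) (p : X → U i) : Prop :=
  (∀ x, J G (detJ (Function.update π i p)) i x ≤ J G (detJ π) i x) ∧
  ∃ x, J G (detJ (Function.update π i p)) i x < J G (detJ π) i x

/-- One step of a strict best reply path: exactly one DM deviates, to a strict best reply. -/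
def StrictBRStep (G : Game N X U) (π π' : ∀ j, X → U j) : Prop :=
  ∃ i, π' = Function.update π i (π' i) ∧ π' i ≠ π i ∧ IsStrictBestReply G i π (π' i)

/-- One step of a strict better reply path. -/
def StrictBetterStep (G : Game N X U) (π π' : ∀ j, X → U j) : Prop :=
  ∃ i, π' = Function.update π i (π' i) ∧ π' i ≠ π i ∧ IsStrictBetterReply G i π (π' i)

/-- One step of a multi-DM reply path: at least one DM deviates, and every deviating DM
switches to a reply of the kind specified by `rep`. -/
def MultiStep {N : ℕ} {X : Type*} {U : Fin N → Type*}
    (rep : (i : Fin N) → (∀ j, X → U j) → (X → U i) → Prop)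
    (π π' : ∀ j, X → U j) : Prop :=
  π' ≠ π ∧ ∀ i, π' i ≠ π i → rep i π (π' i)

/-- Weak acyclicity with respect to a step relation: from every deterministic joint policy
there is a finite path of steps ending at a deterministic equilibrium policy. -/
def WeaklyAcyclic (G : Game N X U)
    (step : (∀ j, X → U j) → (∀ j, X → U j) → Prop) : Prop :=
  ∀ π : ∀ j, X → U j, ∃ (L : ℕ) (p : ℕ → ∀ j, X → U j),
    p 0 = π ∧ (∀ k < L, step (p k) (p (k + 1))) ∧ IsEquilibrium G (p L)

/-- The optimal-Q Bellman operator `F^i_{σ^{-i}}` of DM `i` against the profile `σ`. -/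
def Fopt (G : Game N X U) (σ : ∀ j, X → U j → ℝ) (i : Fin N) (Q : X → U i → ℝ) :
    X → U i → ℝ :=
  fun x a => ∑ w : ∀ j, U j, (if w i = a then (1 : ℝ) else 0) *
    (∏ j ∈ Finset.univ.erase i, σ j x (w j)) *
    (G.c i x w + G.β i * ∑ y, G.P x w y * ⨅ v, Q y v)

/-- DM `i`'s optimal Q-factors `Q^i_{σ^{-i}}`: the unique fixed point of `Fopt`. -/
def optQ (G : Game N X U) (σ : ∀ j, X → U j → ℝ) (i : Fin N) : X → U i → ℝ :=
  if h : ∃ Q : X → U i → ℝ, Fopt G σ i Q = Q then h.choose else fun _ _ => 0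

/-- The policy-evaluation Bellman operator `F^i_{(p, σ^{-i})}` used by Algorithm 2. -/
def Feval (G : Game N X U) (σ : ∀ j, X → U j → ℝ) (i : Fin N) (p : X → U i)
    (Q : X → U i → ℝ) : X → U i → ℝ :=
  fun x a => ∑ w : ∀ j, U j, (if w i = a then (1 : ℝ) else 0) *
    (∏ j ∈ Finset.univ.erase i, σ j x (w j)) *
    (G.c i x w + G.β i * ∑ y, G.P x w y * Q y (p y))

/-- The Q-factors `Q^i_{(p, σ^{-i})}`: the unique fixed point of `Feval`. -/
def evalQ (G : Game N X U) (σ : ∀ j, X → U j → ℝ) (i : Fin N) (p : X → U i) :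
    X → U i → ℝ :=
  if h : ∃ Q : X → U i → ℝ, Feval G σ i p Q = Q then h.choose else fun _ _ => 0

/-- Maximum-norm distance between two Q-factor arrays. -/
def qdist {i : Fin N} (Q Q' : X → U i → ℝ) : ℝ := ⨆ x : X, ⨆ a : U i, |Q x a - Q' x a|

/-- The `ρ`-perturbation `π̄` of a deterministic joint policy `π`:
`π̄^j = (1 - ρ^j) π^j + ρ^j · (uniform on U^j)`. -/
def perturb (ρ : Fin N → ℝ) (π : ∀ j, X → U j) : ∀ j, X → U j → ℝ :=
  fun j x a => (1 - ρ j) * (if a = π j x then 1 else 0) + ρ j / (Fintype.card (U j) : ℝ)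

/-- `δ̄`: the minimum separation between distinct entries of the optimal Q-factors over
all DMs, states, decisions and deterministic joint policies. -/
def deltaBar (G : Game N X U) : ℝ :=
  sInf {d : ℝ | ∃ (i : Fin N) (x : X) (v w : U i) (π : ∀ j, X → U j),
    optQ G (detJ π) i x v ≠ optQ G (detJ π) i x w ∧
    d = |optQ G (detJ π) i x v - optQ G (detJ π) i x w|}

/-- `δ̌`: the minimum separation between distinct entries of the policy-evaluation
Q-factors (at the evaluated policies) over all DMs, states and deterministic policies. -/
def deltaCheck (G : Game N X U) : ℝ :=
  sInf {d : ℝ | ∃ (i : Fin N) (x : X) (p q : X → U i) (π : ∀ j, X → U j),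
    evalQ G (detJ π) i p x (p x) ≠ evalQ G (detJ π) i q x (q x) ∧
    d = |evalQ G (detJ π) i p x (p x) - evalQ G (detJ π) i q x (q x)|}

/-- Multi-step transition probability along a list of joint decisions. -/
def reachProb (G : Game N X U) : List (∀ i, U i) → X → X → ℝ
  | [], x, y => if y = x then 1 else 0
  | a :: rest, x, y => ∑ z, G.P x a z * reachProb G rest z y

/-- Assumption 1 (reachability): every state can be reached from every state with positive
probability by some finite sequence of joint decisions. -/
def Reachability (G : Game N X U) : Prop :=
  ∀ x y : X, ∃ us : List (∀ i, U i), us ≠ [] ∧ 0 < reachProb G us x y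

/-- The set of `d`-near best replies extracted from learnt Q-factors. -/
def nearBest {i : Fin N} (d : ℝ) (Q : X → U i → ℝ) : Set (X → U i) :=
  {p | ∀ x, Q x (p x) ≤ (⨅ v, Q x v) + d}

/-- Start time `t_k` of the `k`-th exploration phase: `t_0 = 0`, `t_{k+1} = t_k + T_k`. -/
def phaseStart (T : ℕ → ℕ) (k : ℕ) : ℕ := ∑ j ∈ Finset.range k, T j

/-- The number of visits of `(x_t, u_t^i)` during `[s, t)`. -/
def visits {Ω : Type*} (st : ℕ → Ω → X) (act : ℕ → Ω → ∀ i, U i) (i : Fin N)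
    (s t : ℕ) (ω : Ω) : ℕ :=
  ((Finset.Ico s t).filter fun r => st r ω = st t ω ∧ act r ω i = act t ω i).card

/-- One Q-learning update for DM `i` with step size `a` and continuation value `v`:
only the entry `(xt, ut^i)` is modified. -/
def qStepV (G : Game N X U) (i : Fin N) (a : ℝ) (Q : X → U i → ℝ) (xt : X)
    (ut : ∀ j, U j) (v : ℝ) : X → U i → ℝ :=
  fun x b => if x = xt ∧ b = ut i then
    (1 - a) * Q x b + a * (G.c i xt ut + G.β i * v) else Q x b

end DQ

namespace DQ

section

variable {N : ℕ} {X : Type*} {U : Fin N → Type*}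

theorem detJ_update [∀ i, DecidableEq (U i)] (π : ∀ i, X → U i) (i : Fin N) (p : X → U i) :
    detJ (Function.update π i p) = Function.update (detJ π) i (detP p) := by
  funext j
  rcases eq_or_ne j i with rfl | h
  · simp [detJ]
  · simp [detJ, h]

variable [∀ i, Fintype (U i)]

theorem IsProfile.jointProb_nonneg {σ : ∀ i, X → U i → ℝ} (hσ : IsProfile σ) (x : X)
    (a : ∀ i, U i) : 0 ≤ jointProb σ x a :=
  Finset.prod_nonneg fun i _ => (hσ i x).1 (a i)

theorem IsProfile.sum_jointProb {σ : ∀ i, X → U i → ℝ} (hσ : IsProfile σ) (x : X) :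
    ∑ a, jointProb σ x a = 1 := by
  have h := Finset.prod_univ_sum (fun i => (Finset.univ : Finset (U i))) fun i b => σ i x b
  rw [Fintype.piFinset_univ] at h
  unfold jointProb
  rw [← h]
  exact Finset.prod_eq_one fun i _ => (hσ i x).2

theorem isRandPol_detP [∀ i, DecidableEq (U i)] {i : Fin N} (p : X → U i) :
    IsRandPol (detP p) := by
  intro x
  refine ⟨fun a => ?_, by simp [detP]⟩
  unfold detP
  split_ifs <;> norm_num

theorem isProfile_detJ [∀ i, DecidableEq (U i)] (π : ∀ i, X → U i) : IsProfile (detJ π) :=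
  fun i => isRandPol_detP (π i)

theorem IsProfile.update {σ : ∀ i, X → U i → ℝ} (hσ : IsProfile σ) {i : Fin N}
    {σi : X → U i → ℝ} (hi : IsRandPol σi) : IsProfile (Function.update σ i σi) := by
  intro j
  rcases eq_or_ne j i with rfl | h
  · simpa using hi
  · simpa [h] using hσ j

variable [Fintype X]

/-- The state transition matrix under the profile `σ`. -/
def transMat (G : Game N X U) (σ : ∀ i, X → U i → ℝ) : Matrix X X ℝ :=
  fun x y => ∑ a, jointProb σ x a * G.P x a y

theorem transMat_nonneg (G : Game N X U) {σ : ∀ i, X → U i → ℝ} (hσ : IsProfile σ) (x y : X) :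
    0 ≤ transMat G σ x y :=
  Finset.sum_nonneg fun a _ => mul_nonneg (hσ.jointProb_nonneg x a) (G.P_nonneg x a y)

theorem sum_transMat (G : Game N X U) {σ : ∀ i, X → U i → ℝ} (hσ : IsProfile σ) (x : X) :
    ∑ y, transMat G σ x y = 1 := by
  unfold transMat
  rw [Finset.sum_comm]
  simp [← Finset.mul_sum, G.P_sum_one, hσ.sum_jointProb]

/-- The expected one-stage cost of DM `i` at each state under the profile `σ`. -/
def meanCost (G : Game N X U) (σ : ∀ i, X → U i → ℝ) (i : Fin N) : X → ℝ :=
  fun x => ∑ a, jointProb σ x a * G.c i x a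

theorem stageCost_iterate_stepOp (G : Game N X U) (σ : ∀ i, X → U i → ℝ) (i : Fin N) (t : ℕ)
    (μ : X → ℝ) :
    stageCost G σ i ((stepOp G σ)^[t] μ) =
      μ ⬝ᵥ ((transMat G σ).mulVec^[t] (meanCost G σ i)) := by
  induction t generalizing μ with
  | zero => rfl
  | succ t ih =>
    rw [Function.iterate_succ_apply, ih, Function.iterate_succ_apply', Matrix.dotProduct_mulVec]
    rfl

theorem abs_iterate_mulVec_le {K : Matrix X X ℝ} (hK : ∀ x y, 0 ≤ K x y)
    (hK1 : ∀ x, ∑ y, K x y = 1) {v : X → ℝ} {M : ℝ} (hv : ∀ x, |v x| ≤ M) (t : ℕ) (x : X) :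
    |K.mulVec^[t] v x| ≤ M := by
  induction t generalizing x with
  | zero => exact hv x
  | succ t ih =>
    rw [Function.iterate_succ_apply']
    calc |∑ y, K x y * K.mulVec^[t] v y| ≤ ∑ y, |K x y * K.mulVec^[t] v y| :=
          Finset.abs_sum_le_sum_abs _ _
      _ ≤ ∑ y, K x y * M := by
          refine Finset.sum_le_sum fun y _ => ?_
          rw [abs_mul, abs_of_nonneg (hK x y)]
          exact mul_le_mul_of_nonneg_left (ih y) (hK x y)
      _ = M := by rw [← Finset.sum_mul, hK1, one_mul]

theorem summable_discounted_iterate {K : Matrix X X ℝ} (hK : ∀ x y, 0 ≤ K x y)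
    (hK1 : ∀ x, ∑ y, K x y = 1) {β : ℝ} (h0 : 0 ≤ β) (h1 : β < 1) (v : X → ℝ) (x : X) :
    Summable fun t : ℕ => β ^ t * K.mulVec^[t] v x := by
  have hv : ∀ x, |v x| ≤ ∑ y, |v y| := fun x =>
    Finset.single_le_sum (f := fun y => |v y|) (fun y _ => abs_nonneg _) (Finset.mem_univ x)
  refine Summable.of_norm_bounded ((summable_geometric_of_lt_one h0 h1).mul_right (∑ y, |v y|))
    fun t => ?_
  rw [Real.norm_eq_abs, abs_mul, abs_of_nonneg (pow_nonneg h0 t)]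
  exact mul_le_mul_of_nonneg_left (abs_iterate_mulVec_le hK hK1 hv t x) (pow_nonneg h0 t)

theorem tsum_discounted_iterate_eq {K : Matrix X X ℝ} (hK : ∀ x y, 0 ≤ K x y)
    (hK1 : ∀ x, ∑ y, K x y = 1) {β : ℝ} (h0 : 0 ≤ β) (h1 : β < 1) (v : X → ℝ) (x : X) :
    ∑' t : ℕ, β ^ t * K.mulVec^[t] v x =
      v x + β * ∑ y, K x y * ∑' t : ℕ, β ^ t * K.mulVec^[t] v y := by
  have hs := summable_discounted_iterate hK hK1 h0 h1 v
  rw [(hs x).tsum_eq_zero_add]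
  congr 1
  · simp
  · simp_rw [← tsum_mul_left]
    rw [← Summable.tsum_finsetSum fun y _ => (hs y).mul_left _, ← tsum_mul_left]
    refine tsum_congr fun t => ?_
    rw [Function.iterate_succ_apply', Matrix.mulVec, dotProduct, Finset.mul_sum, Finset.mul_sum]
    exact Finset.sum_congr rfl fun y _ => by ring

/-- The Bellman evaluation operator of DM `i` under the profile `σ`. -/
def bellman (G : Game N X U) (σ : ∀ i, X → U i → ℝ) (i : Fin N) (V : X → ℝ) (x : X) : ℝ :=
  ∑ a, jointProb σ x a * (G.c i x a + G.β i * ∑ y, G.P x a y * V y)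

theorem bellman_eq (G : Game N X U) (σ : ∀ i, X → U i → ℝ) (i : Fin N) (V : X → ℝ) (x : X) :
    bellman G σ i V x = meanCost G σ i x + G.β i * ∑ y, transMat G σ x y * V y := by
  unfold bellman meanCost transMat
  simp_rw [mul_add, Finset.sum_add_distrib, Finset.sum_mul, Finset.mul_sum]
  congr 1
  rw [Finset.sum_comm]
  exact Finset.sum_congr rfl fun y _ => Finset.sum_congr rfl fun a _ => by ring

theorem bellman_J [DecidableEq X] (G : Game N X U) {σ : ∀ i, X → U i → ℝ} (hσ : IsProfile σ)
    (i : Fin N) : bellman G σ i (J G σ i) = J G σ i := by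
  have hJ : ∀ x, J G σ i x =
      ∑' t : ℕ, G.β i ^ t * (transMat G σ).mulVec^[t] (meanCost G σ i) x := by
    intro x
    refine tsum_congr fun t => ?_
    rw [stageCost_iterate_stepOp]
    simp [dirac, dotProduct]
  funext x
  simp_rw [bellman_eq, hJ]
  exact (tsum_discounted_iterate_eq (transMat_nonneg G hσ) (sum_transMat G hσ) (G.β_pos i).le
    (G.β_lt_one i) _ x).symm

theorem le_of_bellman_sub_le [Nonempty X] (G : Game N X U) {σ : ∀ i, X → U i → ℝ}
    (hσ : IsProfile σ) (i : Fin N) {V W : X → ℝ} (hV : ∀ x, V x ≤ bellman G σ i V x)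
    (hW : ∀ x, bellman G σ i W x ≤ W x) (x : X) : V x ≤ W x := by
  obtain ⟨z, hz⟩ := Finite.exists_max fun x => V x - W x
  have hK : ∑ y, transMat G σ z y * (V y - W y) ≤ V z - W z :=
    calc ∑ y, transMat G σ z y * (V y - W y) ≤ ∑ y, transMat G σ z y * (V z - W z) :=
          Finset.sum_le_sum fun y _ => mul_le_mul_of_nonneg_left (hz y) (transMat_nonneg G hσ z y)
      _ = V z - W z := by rw [← Finset.sum_mul, sum_transMat G hσ, one_mul]
  have h1 := hV z
  have h2 := hW z
  rw [bellman_eq] at h1 h2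
  simp_rw [mul_sub, Finset.sum_sub_distrib] at hK
  have h3 := mul_le_mul_of_nonneg_left hK (G.β_pos i).le
  have h4 : V z - W z ≤ 0 := by
    have := G.β_lt_one i
    nlinarith
  linarith [hz x]

theorem bellman_mono (G : Game N X U) {σ : ∀ i, X → U i → ℝ} (hσ : IsProfile σ) (i : Fin N)
    {V W : X → ℝ} (h : ∀ x, V x ≤ W x) (x : X) : bellman G σ i V x ≤ bellman G σ i W x := by
  simp_rw [bellman_eq]
  have := (G.β_pos i).le
  gcongr with y
  · exact transMat_nonneg G hσ x y
  · exact h y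

theorem bellman_update [∀ i, DecidableEq (U i)] (G : Game N X U) (σ : ∀ i, X → U i → ℝ)
    (i : Fin N) (σi : X → U i → ℝ) (V : X → ℝ) (x : X) :
    bellman G (Function.update σ i σi) i V x =
      ∑ b, σi x b * bellman G (Function.update σ i (detP fun _ => b)) i V x := by
  have key : ∀ (τ : X → U i → ℝ) (a : ∀ i, U i), jointProb (Function.update σ i τ) x a =
      τ x (a i) * ∏ j ∈ Finset.univ.erase i, σ j x (a j) := by
    intro τ a
    unfold jointProb
    rw [← Finset.mul_prod_erase _ _ (Finset.mem_univ i), Function.update_self]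
    congr 1
    exact Finset.prod_congr rfl fun j hj => by
      rw [Function.update_of_ne (Finset.ne_of_mem_erase hj)]
  unfold bellman
  simp_rw [key, Finset.mul_sum]
  rw [Finset.sum_comm]
  refine Finset.sum_congr rfl fun a _ => ?_
  simp [detP]
  ring

theorem bellman_update_detP [∀ i, DecidableEq (U i)] (G : Game N X U) (σ : ∀ i, X → U i → ℝ)
    (i : Fin N) (p : X → U i) (V : X → ℝ) (x : X) :
    bellman G (Function.update σ i (detP p)) i V x =
      bellman G (Function.update σ i (detP fun _ => p x)) i V x := by
  rw [bellman_update]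
  simp [detP]

theorem exists_isBestReply [Nonempty X] [∀ i, Nonempty (U i)] [DecidableEq X]
    [∀ i, DecidableEq (U i)] (G : Game N X U) {σ : ∀ i, X → U i → ℝ} (hσ : IsProfile σ)
    (i : Fin N) : ∃ p : X → U i, IsBestReply G i σ p := by
  obtain ⟨p, hp⟩ := Finite.exists_min fun p : X → U i =>
    ∑ x, J G (Function.update σ i (detP p)) i x
  refine ⟨p, ?_⟩
  set V := J G (Function.update σ i (detP p)) i with hVdef
  have hV : bellman G (Function.update σ i (detP p)) i V = V :=
    bellman_J G (hσ.update (isRandPol_detP p)) i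
  have hopt : ∀ x b, V x ≤ bellman G (Function.update σ i (detP fun _ => b)) i V x := by
    intro x b
    by_contra! hlt
    -- Policy improvement at the single state `x`.
    have hq := hσ.update (isRandPol_detP (Function.update p x b))
    set τ := Function.update σ i (detP (Function.update p x b)) with hτ
    have hx : bellman G τ i V x < V x := by
      rw [hτ, bellman_update_detP]
      simpa using hlt
    have hle : ∀ y, bellman G τ i V y ≤ V y := by
      intro y
      rcases eq_or_ne y x with rfl | hy
      · exact hx.le
      · rw [hτ, bellman_update_detP, Function.update_of_ne hy, ← bellman_update_detP, hV]
    have hJ := bellman_J G hq i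
    have hJV := le_of_bellman_sub_le G hq i (fun y => (congrFun hJ y).ge) hle
    have hJx : J G τ i x < V x := by
      rw [← hJ]
      exact (bellman_mono G hq i hJV x).trans_lt hx
    exact (hp (Function.update p x b)).not_gt
      (Finset.sum_lt_sum (fun y _ => hJV y) ⟨x, Finset.mem_univ x, hJx⟩)
  intro x σi hσi
  have hq := hσ.update hσi
  refine le_of_bellman_sub_le G hq i (fun y => ?_) (fun y => (congrFun (bellman_J G hq i) y).le) x
  rw [bellman_update]
  calc V y = ∑ b, σi y b * V y := by rw [← Finset.sum_mul, (hσi y).2, one_mul]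
    _ ≤ _ := Finset.sum_le_sum fun b _ => mul_le_mul_of_nonneg_left (hopt y b) ((hσi y).1 b)

theorem exists_isStrictBestReply [Nonempty X] [∀ i, Nonempty (U i)] [DecidableEq X]
    [∀ i, DecidableEq (U i)] (G : Game N X U) {π : ∀ i, X → U i} {i : Fin N}
    (h : ¬ IsBestReply G i (detJ π) (π i)) : ∃ p : X → U i, IsStrictBestReply G i π p := by
  obtain ⟨p, hp⟩ := exists_isBestReply G (isProfile_detJ π) i
  refine ⟨p, hp, ?_⟩
  by_contra! hle
  refine h fun x σi hσi => le_trans ?_ (hp x σi hσi)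
  rw [← detJ_update, ← detJ_update, Function.update_eq_self]
  exact hle x

theorem IsStrictBestReply.isStrictBetterReply [DecidableEq X] [∀ i, DecidableEq (U i)]
    {G : Game N X U} {π : ∀ i, X → U i} {i : Fin N} {p : X → U i}
    (h : IsStrictBestReply G i π p) : IsStrictBetterReply G i π p := by
  refine ⟨fun x => ?_, h.2⟩
  have := h.1 x _ (isRandPol_detP (π i))
  rwa [← detJ_update, ← detJ_update, Function.update_eq_self] at this

theorem IsStrictBestReply.strictBRStep [DecidableEq X] [∀ i, DecidableEq (U i)]
    {G : Game N X U} {π : ∀ i, X → U i} {i : Fin N} {p : X → U i}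
    (h : IsStrictBestReply G i π p) : StrictBRStep G π (Function.update π i p) := by
  refine ⟨i, by simp, ?_, by simpa using h⟩
  rw [Function.update_self]
  rintro rfl
  obtain ⟨x, hx⟩ := h.2
  simp at hx

theorem IsStrictBetterReply.sum_J_lt [DecidableEq X] [∀ i, DecidableEq (U i)]
    {G : Game N X U} (hc : ∀ i j, G.c i = G.c j) (hβ : ∀ i j, G.β i = G.β j)
    {π : ∀ i, X → U i} {i : Fin N} {p : X → U i} (h : IsStrictBetterReply G i π p) :
    ∑ j, ∑ x, J G (detJ (Function.update π i p)) j x < ∑ j, ∑ x, J G (detJ π) j x := by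
  have hJ : ∀ σ j, J G σ j = J G σ i := by
    intro σ j
    funext x
    unfold J stageCost
    rw [hc j i, hβ j i]
  simp_rw [hJ _ _]
  refine Finset.sum_lt_sum_of_nonempty ⟨i, Finset.mem_univ i⟩ fun j _ => ?_
  obtain ⟨x, hx⟩ := h.2
  exact Finset.sum_lt_sum (fun y _ => h.1 y) ⟨x, Finset.mem_univ x, hx⟩

theorem weaklyAcyclic_of_potential [DecidableEq X] [∀ i, DecidableEq (U i)] (G : Game N X U)
    {step : (∀ j, X → U j) → (∀ j, X → U j) → Prop} (Φ : (∀ j, X → U j) → ℝ)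
    (h : ∀ π, ¬ IsEquilibrium G π → ∃ π', step π π' ∧ Φ π' < Φ π) : WeaklyAcyclic G step := by
  have : IsTrans (∀ j, X → U j) (InvImage (· < ·) Φ) := ⟨fun _ _ _ => lt_trans⟩
  have : Std.Irrefl (InvImage (· < ·) Φ) := ⟨fun _ => lt_irrefl _⟩
  intro π
  induction π using (Finite.wellFounded_of_trans_of_irrefl (InvImage (· < ·) Φ)).induction with
  | _ π ih =>
    by_cases he : IsEquilibrium G π
    · exact ⟨0, fun _ => π, rfl, by simp, he⟩
    · obtain ⟨π', hstep, hlt⟩ := h π he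
      obtain ⟨L, p, h0, hp, hL⟩ := ih π' hlt
      refine ⟨L + 1, fun | 0 => π | k + 1 => p k, rfl, fun k hk => ?_, hL⟩
      cases k with
      | zero => simpa [h0] using hstep
      | succ k => exact hp k (by omega)

end

/-- Team problems are weakly acyclic under strict best replies: in any finite discounted
stochastic game in which all DMs have the same cost function and the same discount factor,
from every deterministic joint policy there is a strict best reply path ending at a
deterministic equilibrium policy. -/
theorem stmt18
    {N : ℕ} {X : Type} {U : Fin N → Type}
    [Fintype X] [Nonempty X] [∀ i, Fintype (U i)] [∀ i, Nonempty (U i)]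
    [DecidableEq X] [∀ i, DecidableEq (U i)]
    (G : Game N X U)
    (hc : ∀ i j, G.c i = G.c j) (hβ : ∀ i j, G.β i = G.β j) :
    WeaklyAcyclic G (StrictBRStep G) := by
  refine weaklyAcyclic_of_potential G (fun π => ∑ j, ∑ x, J G (detJ π) j x) fun π he => ?_
  obtain ⟨i, hi⟩ := not_forall.mp he
  obtain ⟨p, hp⟩ := exists_isStrictBestReply G hi
  exact ⟨_, hp.strictBRStep, hp.isStrictBetterReply.sum_J_lt hc hβ⟩

end DQ
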